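/- Let H ∈ ℂ[x,y,z] be a smooth quartic form, and let g₄, g₆ ∈ ℂ[s,t,u] be the homogeneous polynomials of degrees 4 and 6 with h₂ = u⁴·g₄ and h₃ = u⁶·g₆. Then g₄³ and g₆² are linearly independent over ℂ; in particular g₄ is not the zero polynomial and the j-function j_C = 1728·(4g₄³)/(4g₄³ − 27g₆²) is not a constant rational function. -/

import Mathlib

open MvPolynomial

open scoped Topology

theorem hasDerivAt_eval_curve {σ : Type*} [Fintype σ] (P : MvPolynomial σ ℂ)
    {γ : ℂ → σ → ℂ} {γ' : σ → ℂ} {t : ℂ} (hγ : ∀ i, HasDerivAt (fun s => γ s i) (γ' i) t) :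
    HasDerivAt (fun s => eval (γ s) P) (∑ i, γ' i * eval (γ t) (pderiv i P)) t := by
  classical
  induction P using MvPolynomial.induction_on with
  | C a => simpa using hasDerivAt_const t a
  | add p q hp hq =>
    simp only [map_add, mul_add, Finset.sum_add_distrib]
    exact hp.add hq
  | mul_X p i hp =>
    simp only [eval_mul, eval_X]
    refine (hp.mul (hγ i)).congr_deriv ?_
    have hsingle : ∀ j, eval (γ t) (Pi.single (M := fun _ => MvPolynomial σ ℂ) j 1 i) =
        if j = i then 1 else 0 := by
      intro j
      by_cases h : j = i
      · simp [h]
      · simp [h, Ne.symm h]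
    simp only [Derivation.leibniz, pderiv_X, smul_eq_mul, eval_add, eval_mul, eval_X, mul_add,
      Finset.sum_add_distrib, hsingle, mul_ite, mul_one, mul_zero, Finset.sum_ite_eq',
      Finset.mem_univ, if_true, Finset.sum_mul]
    rw [add_comm]
    congr 1
    · ring
    · exact Finset.sum_congr rfl fun j _ => by ring

theorem eventually_eval_eq_zero_of_flex (P : MvPolynomial (Fin 2) ℂ)
    (h0 : eval ![0, 0] P = 0) (hx0 : eval ![0, 0] (pderiv 0 P) = 0)
    (hz0 : eval ![0, 0] (pderiv 1 P) ≠ 0)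
    (hflex : ∀ x z : ℂ, eval ![x, z] P = 0 → eval ![x, z] (pderiv 1 P) ≠ 0 →
      eval ![x, z] (pderiv 0 (pderiv 0 P)) * eval ![x, z] (pderiv 1 P) ^ 2
        - (eval ![x, z] (pderiv 1 (pderiv 0 P)) + eval ![x, z] (pderiv 0 (pderiv 1 P)))
          * eval ![x, z] (pderiv 0 P) * eval ![x, z] (pderiv 1 P)
        + eval ![x, z] (pderiv 1 (pderiv 1 P)) * eval ![x, z] (pderiv 0 P) ^ 2 = 0) :
    ∀ᶠ x in 𝓝 (0 : ℂ), eval ![x, 0] P = 0 := by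
  have curve : ∀ (Q : MvPolynomial (Fin 2) ℂ) (φ : ℂ → ℂ) (x d : ℂ), HasDerivAt φ d x →
      HasDerivAt (fun t => eval ![t, φ t] Q)
        (eval ![x, φ x] (pderiv 0 Q) + d * eval ![x, φ x] (pderiv 1 Q)) x := by
    intro Q φ x d hφ
    have := hasDerivAt_eval_curve Q (γ := fun t => ![t, φ t]) (γ' := ![1, d]) (t := x)
      (by intro i; fin_cases i <;> simp [hφ, hasDerivAt_id'])
    simpa [Fin.sum_univ_two] using this
  have cd : ContDiff ℂ 1 (fun v : ℂ × ℂ => eval ![v.1, v.2] P) := by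
    have h : ∀ Q : MvPolynomial (Fin 2) ℂ, ContDiff ℂ 1 (fun v : ℂ × ℂ => eval ![v.1, v.2] Q) := by
      intro Q
      induction Q using MvPolynomial.induction_on with
      | C a => simpa using contDiff_const
      | add p q hp hq => simpa using hp.add hq
      | mul_X p i hp =>
        simp only [eval_mul, eval_X]
        refine hp.mul ?_
        fin_cases i
        · simpa using contDiff_fst
        · simpa using contDiff_snd
    exact h P
  have hinv : (fderiv ℂ (fun v : ℂ × ℂ => eval ![v.1, v.2] P) (0, 0) ∘L
      .inr ℂ ℂ ℂ).IsInvertible := by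
    have h1 : HasDerivAt (fun t : ℂ => eval ![0, t] P) (eval ![0, 0] (pderiv 1 P)) 0 := by
      have := hasDerivAt_eval_curve P (γ := fun t => ![0, t]) (γ' := ![0, 1]) (t := 0)
        (by intro i; fin_cases i <;> simp [hasDerivAt_id', hasDerivAt_const])
      simpa [Fin.sum_univ_two] using this
    have h2 : HasDerivAt (fun t : ℂ => eval ![0, t] P)
        (fderiv ℂ (fun v : ℂ × ℂ => eval ![v.1, v.2] P) (0, 0) (0, 1)) 0 :=
      HasFDerivAt.comp_hasDerivAt (x := (0 : ℂ)) (f := fun t : ℂ => ((0 : ℂ), t))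
        (l := fun v : ℂ × ℂ => eval ![v.1, v.2] P)
        ((cd.differentiable one_ne_zero) (0, 0)).hasFDerivAt
        ((hasDerivAt_const _ _).prodMk (hasDerivAt_id' _))
    have h3 := h2.unique h1
    refine ⟨ContinuousLinearEquiv.unitsEquivAut ℂ (Units.mk0 _ hz0), ?_⟩
    ext
    simp [h3]
  have cdA := cd.contDiffAt (x := (0, 0))
  set φ := cdA.implicitFunction one_ne_zero hinv with hφ
  have hφ0 : φ 0 = 0 := cdA.implicitFunction_apply_self one_ne_zero hinv
  have hφP : ∀ᶠ x in 𝓝 (0 : ℂ), eval ![x, φ x] P = 0 := by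
    have := cdA.eventually_apply_implicitFunction one_ne_zero hinv
    simpa [h0] using this
  have hφc : ContDiffAt ℂ 1 φ 0 := cdA.contDiffAt_implicitFunction one_ne_zero hinv
  have hφd : ∀ᶠ x in 𝓝 (0 : ℂ), DifferentiableAt ℂ φ x := by
    filter_upwards [hφc.eventually (by simp)] with x hx
    exact hx.differentiableAt one_ne_zero
  have hφz : ∀ᶠ x in 𝓝 (0 : ℂ), eval ![x, φ x] (pderiv 1 P) ≠ 0 := by
    have hc := (curve (pderiv 1 P) φ 0 _ hφd.self_of_nhds.hasDerivAt).continuousAt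
    refine hc.eventually_ne ?_
    simpa [hφ0] using hz0
  obtain ⟨r, hr, hball⟩ := Metric.eventually_nhds_iff_ball.1 (hφP.eventually_nhds.and (hφd.and hφz))
  have hmem : (0 : ℂ) ∈ Metric.ball (0 : ℂ) r := Metric.mem_ball_self hr
  have hder : ∀ x ∈ Metric.ball (0 : ℂ) r, deriv φ x =
      -(eval ![x, φ x] (pderiv 0 P) / eval ![x, φ x] (pderiv 1 P)) := by
    intro x hx
    obtain ⟨h1, h2, h3⟩ := hball x hx
    have := (curve P φ x _ h2.hasDerivAt).unique
      ((hasDerivAt_const x (0 : ℂ)).congr_of_eventuallyEq h1)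
    field_simp
    linear_combination this
  have hslope : ∀ x ∈ Metric.ball (0 : ℂ) r,
      eval ![x, φ x] (pderiv 0 P) / eval ![x, φ x] (pderiv 1 P) = 0 := by
    intro x hx
    have hd : ∀ x ∈ Metric.ball (0 : ℂ) r, HasDerivAt (fun x =>
        eval ![x, φ x] (pderiv 0 P) / eval ![x, φ x] (pderiv 1 P)) 0 x := by
      intro x hx
      obtain ⟨h1, h2, h3⟩ := hball x hx
      refine ((curve (pderiv 0 P) φ x _ h2.hasDerivAt).div
        (curve (pderiv 1 P) φ x _ h2.hasDerivAt) h3).congr_deriv ?_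
      have hW := hflex x (φ x) h1.self_of_nhds h3
      rw [hder x hx]
      field_simp
      linear_combination hW
    have := Metric.isOpen_ball.is_const_of_deriv_eq_zero
      (convex_ball (0 : ℂ) r).isPreconnected
      (fun y hy => (hd y hy).differentiableAt.differentiableWithinAt)
      (fun y hy => (hd y hy).deriv) hx hmem
    rw [this, hφ0, hx0, zero_div]
  have hzero : ∀ x ∈ Metric.ball (0 : ℂ) r, φ x = 0 := by
    intro x hx
    rw [← hφ0]
    exact Metric.isOpen_ball.is_const_of_deriv_eq_zero
      (convex_ball (0 : ℂ) r).isPreconnected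
      (fun y hy => (hball y hy).2.1.differentiableWithinAt)
      (fun y hy => by rw [hder y hy, hslope y hy]; simp) hx hmem
  filter_upwards [Metric.ball_mem_nhds (0 : ℂ) hr] with x hx
  have := (hball x hx).1.self_of_nhds
  rwa [hzero x hx] at this

/-- The ternary quartic in which `k i j` is the coefficient of `x ^ i * y ^ j * z ^ (4 - i - j)`. -/
def ternaryQuartic (k : ℕ → ℕ → ℂ) (x y z : ℂ) : ℂ :=
  k 4 0 * x ^ 4 + k 3 1 * x ^ 3 * y + k 2 2 * x ^ 2 * y ^ 2 + k 1 3 * x * y ^ 3 + k 0 4 * y ^ 4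
    + z * (k 3 0 * x ^ 3 + k 2 1 * x ^ 2 * y + k 1 2 * x * y ^ 2 + k 0 3 * y ^ 3)
    + z ^ 2 * (k 2 0 * x ^ 2 + k 1 1 * x * y + k 0 2 * y ^ 2)
    + z ^ 3 * (k 1 0 * x + k 0 1 * y) + k 0 0 * z ^ 4

def ternaryQuarticX (k : ℕ → ℕ → ℂ) (x y z : ℂ) : ℂ :=
  4 * k 4 0 * x ^ 3 + 3 * k 3 1 * x ^ 2 * y + 2 * k 2 2 * x * y ^ 2 + k 1 3 * y ^ 3
    + z * (3 * k 3 0 * x ^ 2 + 2 * k 2 1 * x * y + k 1 2 * y ^ 2)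
    + z ^ 2 * (2 * k 2 0 * x + k 1 1 * y) + z ^ 3 * k 1 0

def ternaryQuarticY (k : ℕ → ℕ → ℂ) (x y z : ℂ) : ℂ :=
  k 3 1 * x ^ 3 + 2 * k 2 2 * x ^ 2 * y + 3 * k 1 3 * x * y ^ 2 + 4 * k 0 4 * y ^ 3
    + z * (k 2 1 * x ^ 2 + 2 * k 1 2 * x * y + 3 * k 0 3 * y ^ 2)
    + z ^ 2 * (k 1 1 * x + 2 * k 0 2 * y) + z ^ 3 * k 0 1

def ternaryQuarticZ (k : ℕ → ℕ → ℂ) (x y z : ℂ) : ℂ :=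
  k 3 0 * x ^ 3 + k 2 1 * x ^ 2 * y + k 1 2 * x * y ^ 2 + k 0 3 * y ^ 3
    + 2 * z * (k 2 0 * x ^ 2 + k 1 1 * x * y + k 0 2 * y ^ 2)
    + 3 * z ^ 2 * (k 1 0 * x + k 0 1 * y) + 4 * k 0 0 * z ^ 3

theorem exists_eval_eq_ternaryQuartic {P : MvPolynomial (Fin 3) ℂ} (hP : P.IsHomogeneous 4) :
    ∃ k : ℕ → ℕ → ℂ, ∀ x y z : ℂ, eval ![x, y, z] P = ternaryQuartic k x y z := by
  classical
  let m : ℕ × ℕ → Fin 3 →₀ ℕ := fun d => Finsupp.equivFunOnFinite.symm ![d.1, d.2, 4 - d.1 - d.2]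
  refine ⟨fun i j => coeff (m (i, j)) P, fun x y z => ?_⟩
  let S : Finset (ℕ × ℕ) := (Finset.range 5 ×ˢ Finset.range 5).filter fun d => d.1 + d.2 ≤ 4
  have hsub : P.support ⊆ S.image m := by
    intro d hd
    have h4 : d 0 + d 1 + d 2 = 4 := by
      have := hP.degree_eq_sum_deg_support hd
      rw [Finset.sum_subset (Finset.subset_univ _) (by simp), Fin.sum_univ_three] at this
      exact this.symm
    refine Finset.mem_image.2 ⟨(d 0, d 1), ?_, ?_⟩
    · simp only [S, Finset.mem_filter, Finset.mem_product, Finset.mem_range]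
      omega
    · ext i
      fin_cases i
      · rfl
      · rfl
      · change 4 - d 0 - d 1 = d 2
        omega
  have hinj : Set.InjOn m S := fun p _ q _ h =>
    Prod.ext (DFunLike.congr_fun h 0) (DFunLike.congr_fun h 1)
  rw [eval_eq', Finset.sum_subset hsub, Finset.sum_image hinj]
  · simp [S, m, Fin.prod_univ_three, ternaryQuartic, Finset.sum_filter, Finset.sum_product,
      Finset.sum_range_succ]
    ring
  · intro d _ hd
    simp [notMem_support_iff.1 hd]

theorem exists_eval_comb_eq_ternaryQuartic {H : MvPolynomial (Fin 3) ℂ} (hH : H.IsHomogeneous 4)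
    (a b c : Fin 3 → ℂ) :
    ∃ k : ℕ → ℕ → ℂ, ∀ x y z : ℂ, eval (x • a + y • b + z • c) H = ternaryQuartic k x y z := by
  have hP : (aeval (fun i => C (a i) * X 0 + C (b i) * X 1 + C (c i) * X 2 :
      Fin 3 → MvPolynomial (Fin 3) ℂ) H).IsHomogeneous (1 * 4) :=
    hH.aeval _ fun i => ((isHomogeneous_C_mul_X _ _).add (isHomogeneous_C_mul_X _ _)).add
      (isHomogeneous_C_mul_X _ _)
  obtain ⟨k, hk⟩ := exists_eval_eq_ternaryQuartic hP
  refine ⟨k, fun x y z => ?_⟩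
  rw [← hk, ← coe_aeval_eq_eval, ← coe_aeval_eq_eval, RingHom.coe_coe, RingHom.coe_coe,
    ← AlgHom.comp_apply, comp_aeval]
  congr 2
  ext i
  simp
  ring

def IsSmoothQuartic (k : ℕ → ℕ → ℂ) : Prop :=
  ∀ x y z : ℂ, ternaryQuarticX k x y z = 0 → ternaryQuarticY k x y z = 0 →
    ternaryQuarticZ k x y z = 0 → x = 0 ∧ y = 0 ∧ z = 0

/-- The determinant with rows `a`, `b`, `c`. -/
def tripleDet (a b c : Fin 3 → ℂ) : ℂ :=
  a 0 * (b 1 * c 2 - b 2 * c 1) - a 1 * (b 0 * c 2 - b 2 * c 0) + a 2 * (b 0 * c 1 - b 1 * c 0)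

theorem eq_zero_of_tripleDet_ne_zero {a b c : Fin 3 → ℂ} (h : tripleDet a b c ≠ 0) {n : Fin 3 → ℂ}
    (ha : ∑ i, a i * n i = 0) (hb : ∑ i, b i * n i = 0) (hc : ∑ i, c i * n i = 0) : n = 0 := by
  simp only [Fin.sum_univ_three] at ha hb hc
  have h' := h
  unfold tripleDet at h'
  ext i
  refine (mul_eq_zero.1 (?_ : _ * n i = 0)).resolve_left h'
  fin_cases i
  · simp only [Fin.zero_eta]
    linear_combination (b 1 * c 2 - b 2 * c 1) * ha - (a 1 * c 2 - a 2 * c 1) * hb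
      + (a 1 * b 2 - a 2 * b 1) * hc
  · simp only [Fin.mk_one]
    linear_combination -(b 0 * c 2 - b 2 * c 0) * ha + (a 0 * c 2 - a 2 * c 0) * hb
      - (a 0 * b 2 - a 2 * b 0) * hc
  · simp only [Fin.reduceFinMk]
    linear_combination (b 0 * c 1 - b 1 * c 0) * ha - (a 0 * c 1 - a 1 * c 0) * hb
      + (a 0 * b 1 - a 1 * b 0) * hc

theorem comb_eq_zero_of_tripleDet_ne_zero {a b c : Fin 3 → ℂ} (h : tripleDet a b c ≠ 0)
    {x y z : ℂ} (hq : x • a + y • b + z • c = 0) : x = 0 ∧ y = 0 ∧ z = 0 := by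
  have h0 := congrFun hq 0
  have h1 := congrFun hq 1
  have h2 := congrFun hq 2
  simp only [Pi.add_apply, Pi.smul_apply, smul_eq_mul, Pi.zero_apply] at h0 h1 h2
  unfold tripleDet at h
  refine ⟨(mul_eq_zero.1 (?_ : _ * x = 0)).resolve_left h,
    (mul_eq_zero.1 (?_ : _ * y = 0)).resolve_left h, (mul_eq_zero.1 (?_ : _ * z = 0)).resolve_left h⟩
  · linear_combination (b 1 * c 2 - b 2 * c 1) * h0 - (b 0 * c 2 - b 2 * c 0) * h1
      + (b 0 * c 1 - b 1 * c 0) * h2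
  · linear_combination -(a 1 * c 2 - a 2 * c 1) * h0 + (a 0 * c 2 - a 2 * c 0) * h1
      - (a 0 * c 1 - a 1 * c 0) * h2
  · linear_combination (a 1 * b 2 - a 2 * b 1) * h0 - (a 0 * b 2 - a 2 * b 0) * h1
      + (a 0 * b 1 - a 1 * b 0) * h2

/-- `ternaryQuartic k` as a polynomial. -/
noncomputable def ternaryQuarticPoly (k : ℕ → ℕ → ℂ) : MvPolynomial (Fin 3) ℂ :=
  C (k 4 0) * X 0 ^ 4 + C (k 3 1) * X 0 ^ 3 * X 1 + C (k 2 2) * X 0 ^ 2 * X 1 ^ 2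
    + C (k 1 3) * X 0 * X 1 ^ 3 + C (k 0 4) * X 1 ^ 4
    + X 2 * (C (k 3 0) * X 0 ^ 3 + C (k 2 1) * X 0 ^ 2 * X 1 + C (k 1 2) * X 0 * X 1 ^ 2
      + C (k 0 3) * X 1 ^ 3)
    + X 2 ^ 2 * (C (k 2 0) * X 0 ^ 2 + C (k 1 1) * X 0 * X 1 + C (k 0 2) * X 1 ^ 2)
    + X 2 ^ 3 * (C (k 1 0) * X 0 + C (k 0 1) * X 1) + C (k 0 0) * X 2 ^ 4

theorem eval_ternaryQuarticPoly (k : ℕ → ℕ → ℂ) (x y z : ℂ) :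
    eval ![x, y, z] (ternaryQuarticPoly k) = ternaryQuartic k x y z := by
  simp [ternaryQuarticPoly, ternaryQuartic]

theorem eval_pderiv_ternaryQuarticPoly (k : ℕ → ℕ → ℂ) (x y z : ℂ) (i : Fin 3) :
    eval ![x, y, z] (pderiv i (ternaryQuarticPoly k)) =
      ![ternaryQuarticX k x y z, ternaryQuarticY k x y z, ternaryQuarticZ k x y z] i := by
  fin_cases i <;>
    simp [ternaryQuarticPoly, ternaryQuarticX, ternaryQuarticY, ternaryQuarticZ, pderiv_X,
      Derivation.leibniz, Derivation.leibniz_pow] <;> ring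

theorem isSmoothQuartic_of_eval_comb {H : MvPolynomial (Fin 3) ℂ}
    (hH : ¬ ∃ p : Fin 3 → ℂ, p ≠ 0 ∧ eval p H = 0 ∧ ∀ k : Fin 3, eval p (pderiv k H) = 0)
    {a b c : Fin 3 → ℂ} (hdet : tripleDet a b c ≠ 0) {k : ℕ → ℕ → ℂ}
    (hk : ∀ x y z : ℂ, eval (x • a + y • b + z • c) H = ternaryQuartic k x y z) :
    IsSmoothQuartic k := by
  intro x y z hx hy hz
  by_contra hne
  refine hH ⟨x • a + y • b + z • c, fun h => hne (comb_eq_zero_of_tripleDet_ne_zero hdet h), ?_, ?_⟩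
  · rw [hk]
    unfold ternaryQuarticX at hx
    unfold ternaryQuarticY at hy
    unfold ternaryQuarticZ at hz
    unfold ternaryQuartic
    linear_combination (x * hx + y * hy + z * hz) / 4
  · have hdir : ∀ u v w : ℂ, ∑ i, (u • a + v • b + w • c) i *
        eval (x • a + y • b + z • c) (pderiv i H) = 0 := by
      intro u v w
      have h1 := hasDerivAt_eval_curve H (t := 0)
        (γ := fun t => (x + t * u) • a + (y + t * v) • b + (z + t * w) • c)
        (γ' := u • a + v • b + w • c) (by
          intro i
          simp only [Pi.add_apply, Pi.smul_apply, smul_eq_mul]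
          have hl : ∀ p r : ℂ, HasDerivAt (fun t : ℂ => p + t * r) r 0 := fun p r => by
            simpa using ((hasDerivAt_id (0 : ℂ)).mul_const r).const_add p
          exact (((hl x u).mul_const _).add ((hl y v).mul_const _)).add ((hl z w).mul_const _))
      have h2 := hasDerivAt_eval_curve (ternaryQuarticPoly k) (t := 0)
        (γ := fun t => ![x + t * u, y + t * v, z + t * w]) (γ' := ![u, v, w]) (by
          have hl : ∀ p r : ℂ, HasDerivAt (fun t : ℂ => p + t * r) r 0 := fun p r => by
            simpa using ((hasDerivAt_id (0 : ℂ)).mul_const r).const_add p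
          intro i
          fin_cases i
          · exact hl x u
          · exact hl y v
          · exact hl z w)
      simp only [hk] at h1
      simp only [eval_ternaryQuarticPoly, eval_pderiv_ternaryQuarticPoly] at h2
      have := h1.unique h2
      simpa [Fin.sum_univ_three, hx, hy, hz] using this
    have := eq_zero_of_tripleDet_ne_zero hdet
      (n := fun i => eval (x • a + y • b + z • c) (pderiv i H))
      (by simpa using hdir 1 0 0) (by simpa using hdir 0 1 0) (by simpa using hdir 0 0 1)
    exact fun i => congrFun this i

theorem binaryQuartic_coeff_unique {p₀ p₁ p₂ p₃ p₄ q₀ q₁ q₂ q₃ q₄ : ℂ}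
    (h : ∀ x y : ℂ, p₀ * x ^ 4 + p₁ * x ^ 3 * y + p₂ * x ^ 2 * y ^ 2 + p₃ * x * y ^ 3 + p₄ * y ^ 4
      = q₀ * x ^ 4 + q₁ * x ^ 3 * y + q₂ * x ^ 2 * y ^ 2 + q₃ * x * y ^ 3 + q₄ * y ^ 4) :
    p₀ = q₀ ∧ p₁ = q₁ ∧ p₂ = q₂ ∧ p₃ = q₃ ∧ p₄ = q₄ := by
  have h0 : p₀ = q₀ := by simpa using h 1 0
  have h4 : p₄ = q₄ := by simpa using h 0 1
  have h1 := h 1 1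
  have hm := h 1 (-1)
  have h2 := h 1 2
  refine ⟨h0, ?_, ?_, ?_, h4⟩
  · linear_combination h1 - hm / 3 - h2 / 6 - h0 / 2 + 2 * h4
  · linear_combination h1 / 2 + hm / 2 - h0 - h4
  · linear_combination -h1 / 2 - hm / 6 + h2 / 6 + h0 / 2 - 2 * h4

def quarticI (q₀ q₁ q₂ q₃ q₄ : ℂ) : ℂ := -3 * q₁ * q₃ + 12 * q₀ * q₄ + q₂ ^ 2

def quarticJ (q₀ q₁ q₂ q₃ q₄ : ℂ) : ℂ :=
  72 * q₀ * q₂ * q₄ - 27 * q₀ * q₃ ^ 2 - 27 * q₁ ^ 2 * q₄ + 9 * q₁ * q₂ * q₃ - 2 * q₂ ^ 3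

/-- The binary quartics cut out by `H` on all lines satisfy `α I³ + β J² = 0`. -/
def InvariantRelation (H : MvPolynomial (Fin 3) ℂ) (α β : ℂ) : Prop :=
  ∀ (a b : Fin 3 → ℂ) (q₀ q₁ q₂ q₃ q₄ : ℂ),
    (∀ x y : ℂ, eval (x • a + y • b) H =
      q₀ * x ^ 4 + q₁ * x ^ 3 * y + q₂ * x ^ 2 * y ^ 2 + q₃ * x * y ^ 3 + q₄ * y ^ 4) →
    α * quarticI q₀ q₁ q₂ q₃ q₄ ^ 3 + β * quarticJ q₀ q₁ q₂ q₃ q₄ ^ 2 = 0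

theorem eq_zero_of_mul_eq_zero_of_continuous {f d : ℂ → ℂ} (hf : Continuous f)
    (hd : {ε | d ε = 0}.Finite) (h : ∀ ε, d ε ≠ 0 → f ε = 0) (ε : ℂ) : f ε = 0 := by
  have hdense : Dense {ε | d ε = 0}ᶜ := hd.countable.dense_compl ℂ
  exact congrFun (hf.ext_on hdense continuous_const fun x hx => h x hx) ε

theorem invariantRelation_of_generic {H : MvPolynomial (Fin 3) ℂ} (hH4 : H.IsHomogeneous 4)
    {α β : ℂ}
    (h : ∀ (a b : Fin 3 → ℂ) (q₀ q₁ q₂ q₃ q₄ : ℂ), a 0 * b 1 - a 1 * b 0 ≠ 0 →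
      (∀ x y : ℂ, eval (x • a + y • b) H =
        q₀ * x ^ 4 + q₁ * x ^ 3 * y + q₂ * x ^ 2 * y ^ 2 + q₃ * x * y ^ 3 + q₄ * y ^ 4) →
      α * quarticI q₀ q₁ q₂ q₃ q₄ ^ 3 + β * quarticJ q₀ q₁ q₂ q₃ q₄ ^ 2 = 0) :
    InvariantRelation H α β := by
  intro a b q₀ q₁ q₂ q₃ q₄ hq
  let A : ℂ → Fin 3 → ℂ := fun ε => a + Pi.single 0 ε
  let B : ℂ → Fin 3 → ℂ := fun ε => b + Pi.single 1 ε
  let E : ℂ → ℂ → ℂ → ℂ := fun x y ε => eval (x • A ε + y • B ε) H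
  let S : ℂ → ℂ := fun ε => (E 1 1 ε - E 1 (-1) ε) / 2
  let T : ℂ → ℂ := fun ε => (E 1 1 ε + E 1 (-1) ε) / 2 - E 1 0 ε - E 0 1 ε
  let R : ℂ → ℂ := fun ε => E 1 2 ε - E 1 0 ε - 4 * T ε - 16 * E 0 1 ε
  let V : ℂ → ℂ := fun ε => (R ε - 2 * S ε) / 6
  let U : ℂ → ℂ := fun ε => S ε - V ε
  have hE : ∀ x y, Continuous (E x y) := fun x y => by
    have hA : Continuous A := continuous_const.add (continuous_single (A := fun _ : Fin 3 => ℂ) 0)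
    have hB : Continuous B := continuous_const.add (continuous_single (A := fun _ : Fin 3 => ℂ) 1)
    exact (MvPolynomial.continuous_eval H).comp ((hA.const_smul x).add (hB.const_smul y))
  have hinterp : ∀ (ε p₀ p₁ p₂ p₃ p₄ : ℂ), (∀ x y : ℂ, E x y ε =
      p₀ * x ^ 4 + p₁ * x ^ 3 * y + p₂ * x ^ 2 * y ^ 2 + p₃ * x * y ^ 3 + p₄ * y ^ 4) →
      E 1 0 ε = p₀ ∧ U ε = p₁ ∧ T ε = p₂ ∧ V ε = p₃ ∧ E 0 1 ε = p₄ := by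
    intro ε p₀ p₁ p₂ p₃ p₄ hp
    simp only [U, V, R, T, S, hp]
    refine ⟨?_, ?_, ?_, ?_, ?_⟩ <;> ring
  let Φ : ℂ → ℂ := fun ε =>
    α * quarticI (E 1 0 ε) (U ε) (T ε) (V ε) (E 0 1 ε) ^ 3
      + β * quarticJ (E 1 0 ε) (U ε) (T ε) (V ε) (E 0 1 ε) ^ 2
  have hΦ : Continuous Φ := by
    have h1 := hE 1 1
    have h2 := hE 1 (-1)
    have h3 := hE 1 0
    have h4 := hE 0 1
    have h5 := hE 1 2
    simp only [Φ, U, V, R, T, S, quarticI, quarticJ]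
    fun_prop
  have hfin : {ε : ℂ | (a 0 + ε) * (b 1 + ε) - a 1 * b 0 = 0}.Finite := by
    let p : Polynomial ℂ := (Polynomial.X + Polynomial.C (a 0)) * (Polynomial.X + Polynomial.C (b 1))
      - Polynomial.C (a 1 * b 0)
    have hp : p ≠ 0 := by
      intro h0
      have := congrArg (fun r => Polynomial.eval 0 (Polynomial.derivative
        (Polynomial.derivative r))) h0
      simp [p] at this
    refine (Polynomial.finite_setOfPred_isRoot hp).subset fun ε hε => ?_
    simp only [Set.mem_ofPred_eq, Polynomial.IsRoot, p] at hε ⊢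
    simpa [add_comm] using hε
  have h0 : Φ 0 = 0 := by
    refine eq_zero_of_mul_eq_zero_of_continuous hΦ hfin (fun ε hε => ?_) 0
    obtain ⟨k, hk⟩ := exists_eval_comb_eq_ternaryQuartic hH4 (A ε) (B ε) 0
    have hk' : ∀ x y, E x y ε = k 4 0 * x ^ 4 + k 3 1 * x ^ 3 * y + k 2 2 * x ^ 2 * y ^ 2
        + k 1 3 * x * y ^ 3 + k 0 4 * y ^ 4 := fun x y => by
      have := hk x y 0
      simpa [ternaryQuartic, E] using this
    obtain ⟨e0, e1, e2, e3, e4⟩ := hinterp ε _ _ _ _ _ hk'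
    simp only [Φ, e0, e1, e2, e3, e4]
    exact h (A ε) (B ε) _ _ _ _ _ (by simpa [A, B] using hε) hk'
  obtain ⟨e0, e1, e2, e3, e4⟩ := hinterp 0 q₀ q₁ q₂ q₃ q₄ (by simpa [E, A, B] using hq)
  simpa only [Φ, e0, e1, e2, e3, e4] using h0

theorem invariantRelation_of_standard_lines {H : MvPolynomial (Fin 3) ℂ}
    (hH4 : H.IsHomogeneous 4) {b₀ b₁ b₂ b₃ b₄ : MvPolynomial (Fin 3) ℂ}
    (hb : ∀ s t u x y : ℂ,
      eval ![x * u, y * u, -(s * x + t * y)] H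
        = eval ![s, t, u] b₀ * x ^ 4 + eval ![s, t, u] b₁ * x ^ 3 * y
          + eval ![s, t, u] b₂ * x ^ 2 * y ^ 2 + eval ![s, t, u] b₃ * x * y ^ 3
          + eval ![s, t, u] b₄ * y ^ 4) {α β : ℂ}
    (h : ∀ s t u : ℂ,
      α * quarticI (eval ![s, t, u] b₀) (eval ![s, t, u] b₁) (eval ![s, t, u] b₂)
          (eval ![s, t, u] b₃) (eval ![s, t, u] b₄) ^ 3
        + β * quarticJ (eval ![s, t, u] b₀) (eval ![s, t, u] b₁) (eval ![s, t, u] b₂)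
          (eval ![s, t, u] b₃) (eval ![s, t, u] b₄) ^ 2 = 0) :
    InvariantRelation H α β := by
  refine invariantRelation_of_generic hH4 fun a b q₀ q₁ q₂ q₃ q₄ hδ hq => ?_
  have hrel := h (a 1 * b 2 - a 2 * b 1) (a 2 * b 0 - a 0 * b 2) (a 0 * b 1 - a 1 * b 0)
  have hline := hb (a 1 * b 2 - a 2 * b 1) (a 2 * b 0 - a 0 * b 2) (a 0 * b 1 - a 1 * b 0)
  generalize eval ![a 1 * b 2 - a 2 * b 1, a 2 * b 0 - a 0 * b 2, a 0 * b 1 - a 1 * b 0] b₀ = c₀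
    at hrel hline
  generalize eval ![a 1 * b 2 - a 2 * b 1, a 2 * b 0 - a 0 * b 2, a 0 * b 1 - a 1 * b 0] b₁ = c₁
    at hrel hline
  generalize eval ![a 1 * b 2 - a 2 * b 1, a 2 * b 0 - a 0 * b 2, a 0 * b 1 - a 1 * b 0] b₂ = c₂
    at hrel hline
  generalize eval ![a 1 * b 2 - a 2 * b 1, a 2 * b 0 - a 0 * b 2, a 0 * b 1 - a 1 * b 0] b₃ = c₃
    at hrel hline
  generalize eval ![a 1 * b 2 - a 2 * b 1, a 2 * b 0 - a 0 * b 2, a 0 * b 1 - a 1 * b 0] b₄ = c₄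
    at hrel hline
  have hcoord : ∀ x y : ℂ, ![x * (a 0 * b 1 - a 1 * b 0), y * (a 0 * b 1 - a 1 * b 0),
      -((a 1 * b 2 - a 2 * b 1) * x + (a 2 * b 0 - a 0 * b 2) * y)]
      = (b 1 * x - b 0 * y) • a + (-a 1 * x + a 0 * y) • b := by
    intro x y
    ext i
    fin_cases i <;> simp <;> ring
  simp only [hcoord, hq] at hline
  generalize b 1 = b1 at hline hδ
  generalize b 0 = b0 at hline hδ
  generalize a 1 = a1 at hline hδ
  generalize a 0 = a0 at hline hδ
  obtain ⟨rfl, rfl, rfl, rfl, rfl⟩ := binaryQuartic_coeff_unique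
    (p₀ := q₀ * b1 ^ 4 - q₁ * b1 ^ 3 * a1 + q₂ * b1 ^ 2 * a1 ^ 2 - q₃ * b1 * a1 ^ 3 + q₄ * a1 ^ 4)
    (p₁ := -4 * q₀ * b1 ^ 3 * b0 + q₁ * (b1 ^ 3 * a0 + 3 * b1 ^ 2 * b0 * a1)
      - q₂ * (2 * b1 * b0 * a1 ^ 2 + 2 * b1 ^ 2 * a1 * a0) + q₃ * (3 * b1 * a1 ^ 2 * a0 + b0 * a1 ^ 3)
      - 4 * q₄ * a1 ^ 3 * a0)
    (p₂ := 6 * q₀ * b1 ^ 2 * b0 ^ 2 - q₁ * (3 * b1 ^ 2 * b0 * a0 + 3 * b1 * b0 ^ 2 * a1)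
      + q₂ * (b1 ^ 2 * a0 ^ 2 + 4 * b1 * b0 * a1 * a0 + b0 ^ 2 * a1 ^ 2)
      - q₃ * (3 * b1 * a1 * a0 ^ 2 + 3 * b0 * a1 ^ 2 * a0) + 6 * q₄ * a1 ^ 2 * a0 ^ 2)
    (p₃ := -4 * q₀ * b1 * b0 ^ 3 + q₁ * (3 * b1 * b0 ^ 2 * a0 + b0 ^ 3 * a1)
      - q₂ * (2 * b1 * b0 * a0 ^ 2 + 2 * b0 ^ 2 * a1 * a0) + q₃ * (b1 * a0 ^ 3 + 3 * b0 * a1 * a0 ^ 2)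
      - 4 * q₄ * a1 * a0 ^ 3)
    (p₄ := q₀ * b0 ^ 4 - q₁ * b0 ^ 3 * a0 + q₂ * b0 ^ 2 * a0 ^ 2 - q₃ * b0 * a0 ^ 3 + q₄ * a0 ^ 4)
    (fun x y => Eq.trans (by ring) (hline x y))
  refine (mul_eq_zero.1 (?_ : (a0 * b1 - a1 * b0) ^ 12 * _ = 0)).resolve_left (pow_ne_zero _ hδ)
  have hI : quarticI
      (q₀ * b1 ^ 4 - q₁ * b1 ^ 3 * a1 + q₂ * b1 ^ 2 * a1 ^ 2 - q₃ * b1 * a1 ^ 3 + q₄ * a1 ^ 4)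
      (-4 * q₀ * b1 ^ 3 * b0 + q₁ * (b1 ^ 3 * a0 + 3 * b1 ^ 2 * b0 * a1)
      - q₂ * (2 * b1 * b0 * a1 ^ 2 + 2 * b1 ^ 2 * a1 * a0) + q₃ * (3 * b1 * a1 ^ 2 * a0 + b0 * a1 ^ 3)
      - 4 * q₄ * a1 ^ 3 * a0)
      (6 * q₀ * b1 ^ 2 * b0 ^ 2 - q₁ * (3 * b1 ^ 2 * b0 * a0 + 3 * b1 * b0 ^ 2 * a1)
      + q₂ * (b1 ^ 2 * a0 ^ 2 + 4 * b1 * b0 * a1 * a0 + b0 ^ 2 * a1 ^ 2)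
      - q₃ * (3 * b1 * a1 * a0 ^ 2 + 3 * b0 * a1 ^ 2 * a0) + 6 * q₄ * a1 ^ 2 * a0 ^ 2)
      (-4 * q₀ * b1 * b0 ^ 3 + q₁ * (3 * b1 * b0 ^ 2 * a0 + b0 ^ 3 * a1)
      - q₂ * (2 * b1 * b0 * a0 ^ 2 + 2 * b0 ^ 2 * a1 * a0) + q₃ * (b1 * a0 ^ 3 + 3 * b0 * a1 * a0 ^ 2)
      - 4 * q₄ * a1 * a0 ^ 3)
      (q₀ * b0 ^ 4 - q₁ * b0 ^ 3 * a0 + q₂ * b0 ^ 2 * a0 ^ 2 - q₃ * b0 * a0 ^ 3 + q₄ * a0 ^ 4)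
      = (a0 * b1 - a1 * b0) ^ 4 * quarticI q₀ q₁ q₂ q₃ q₄ := by
    unfold quarticI
    ring
  have hJ : quarticJ
      (q₀ * b1 ^ 4 - q₁ * b1 ^ 3 * a1 + q₂ * b1 ^ 2 * a1 ^ 2 - q₃ * b1 * a1 ^ 3 + q₄ * a1 ^ 4)
      (-4 * q₀ * b1 ^ 3 * b0 + q₁ * (b1 ^ 3 * a0 + 3 * b1 ^ 2 * b0 * a1)
      - q₂ * (2 * b1 * b0 * a1 ^ 2 + 2 * b1 ^ 2 * a1 * a0) + q₃ * (3 * b1 * a1 ^ 2 * a0 + b0 * a1 ^ 3)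
      - 4 * q₄ * a1 ^ 3 * a0)
      (6 * q₀ * b1 ^ 2 * b0 ^ 2 - q₁ * (3 * b1 ^ 2 * b0 * a0 + 3 * b1 * b0 ^ 2 * a1)
      + q₂ * (b1 ^ 2 * a0 ^ 2 + 4 * b1 * b0 * a1 * a0 + b0 ^ 2 * a1 ^ 2)
      - q₃ * (3 * b1 * a1 * a0 ^ 2 + 3 * b0 * a1 ^ 2 * a0) + 6 * q₄ * a1 ^ 2 * a0 ^ 2)
      (-4 * q₀ * b1 * b0 ^ 3 + q₁ * (3 * b1 * b0 ^ 2 * a0 + b0 ^ 3 * a1)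
      - q₂ * (2 * b1 * b0 * a0 ^ 2 + 2 * b0 ^ 2 * a1 * a0) + q₃ * (b1 * a0 ^ 3 + 3 * b0 * a1 * a0 ^ 2)
      - 4 * q₄ * a1 * a0 ^ 3)
      (q₀ * b0 ^ 4 - q₁ * b0 ^ 3 * a0 + q₂ * b0 ^ 2 * a0 ^ 2 - q₃ * b0 * a0 ^ 3 + q₄ * a0 ^ 4)
      = (a0 * b1 - a1 * b0) ^ 6 * quarticJ q₀ q₁ q₂ q₃ q₄ := by
    unfold quarticJ
    ring
  rw [hI, hJ] at hrel
  linear_combination hrel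

/-- The discriminant of a binary quartic. -/
def quarticDisc (a b c d e : ℂ) : ℂ :=
  256 * a ^ 3 * e ^ 3 - 192 * a ^ 2 * b * d * e ^ 2 - 128 * a ^ 2 * c ^ 2 * e ^ 2
    + 144 * a ^ 2 * c * d ^ 2 * e - 27 * a ^ 2 * d ^ 4 + 144 * a * b ^ 2 * c * e ^ 2
    - 6 * a * b ^ 2 * d ^ 2 * e - 80 * a * b * c ^ 2 * d * e + 18 * a * b * c * d ^ 3
    + 16 * a * c ^ 4 * e - 4 * a * c ^ 3 * d ^ 2 - 27 * b ^ 4 * e ^ 2 + 18 * b ^ 3 * c * d * e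
    - 4 * b ^ 3 * d ^ 3 - 4 * b ^ 2 * c ^ 3 * e + b ^ 2 * c ^ 2 * d ^ 2

theorem four_mul_quarticI_pow_sub_quarticJ_sq (a b c d e : ℂ) :
    4 * quarticI a b c d e ^ 3 - quarticJ a b c d e ^ 2 = 27 * quarticDisc a b c d e := by
  unfold quarticI quarticJ quarticDisc
  ring

theorem eq_zero_of_quarticDisc_eq_zero_of_root {a b c d e : ℂ → ℂ} (ha : Continuous a)
    (hb : Continuous b) (hc : Continuous c) (hd : Continuous d) (he : Continuous e)
    (hb0 : b 0 = 0)
    (h : ∀ ε, quarticDisc (a ε) (b ε) (c ε) (ε * d ε) (ε * e ε) = 0) :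
    a 0 * c 0 ^ 4 * e 0 = 0 := by
  have hz := eq_zero_of_mul_eq_zero_of_continuous (d := fun t => t)
    (f := fun t => 256 * a t ^ 3 * t ^ 2 * e t ^ 3 - 192 * a t ^ 2 * b t * d t * t ^ 2 * e t ^ 2
      - 128 * a t ^ 2 * c t ^ 2 * t * e t ^ 2 + 144 * a t ^ 2 * c t * t ^ 2 * d t ^ 2 * e t
      - 27 * a t ^ 2 * t ^ 3 * d t ^ 4 + 144 * a t * b t ^ 2 * c t * t * e t ^ 2
      - 6 * a t * b t ^ 2 * t ^ 2 * d t ^ 2 * e t - 80 * a t * b t * c t ^ 2 * t * d t * e t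
      + 18 * a t * b t * c t * t ^ 2 * d t ^ 3 + 16 * a t * c t ^ 4 * e t
      - 4 * a t * c t ^ 3 * t * d t ^ 2 - 27 * b t ^ 4 * t * e t ^ 2
      + 18 * b t ^ 3 * c t * t * d t * e t - 4 * b t ^ 3 * t ^ 2 * d t ^ 3
      - 4 * b t ^ 2 * c t ^ 3 * e t + b t ^ 2 * c t ^ 2 * t * d t ^ 2) (by fun_prop) (by simp)
    (fun t ht => (mul_eq_zero.1 (Eq.trans (by unfold quarticDisc; ring) (h t))).resolve_left ht) 0
  simp only [hb0] at hz
  linear_combination hz / 16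

theorem eq_zero_of_quarticDisc_eq_zero_of_two_roots {a b c d e : ℂ → ℂ} (ha : Continuous a)
    (hb : Continuous b) (hc : Continuous c) (hd : Continuous d) (he : Continuous e)
    (h : ∀ ε, quarticDisc (ε * a ε) (ε * b ε) (c ε) (ε * d ε) (ε * e ε) = 0) :
    a 0 * c 0 ^ 4 * e 0 = 0 := by
  have hz := eq_zero_of_mul_eq_zero_of_continuous (d := fun t => t ^ 2)
    (f := fun t => 256 * t ^ 4 * a t ^ 3 * e t ^ 3 - 192 * t ^ 4 * a t ^ 2 * b t * d t * e t ^ 2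
      - 128 * t ^ 2 * a t ^ 2 * c t ^ 2 * e t ^ 2 + 144 * t ^ 3 * a t ^ 2 * c t * d t ^ 2 * e t
      - 27 * t ^ 4 * a t ^ 2 * d t ^ 4 + 144 * t ^ 3 * a t * b t ^ 2 * c t * e t ^ 2
      - 6 * t ^ 4 * a t * b t ^ 2 * d t ^ 2 * e t - 80 * t ^ 2 * a t * b t * c t ^ 2 * d t * e t
      + 18 * t ^ 3 * a t * b t * c t * d t ^ 3 + 16 * a t * c t ^ 4 * e t
      - 4 * t * a t * c t ^ 3 * d t ^ 2 - 27 * t ^ 4 * b t ^ 4 * e t ^ 2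
      + 18 * t ^ 3 * b t ^ 3 * c t * d t * e t - 4 * t ^ 4 * b t ^ 3 * d t ^ 3
      - 4 * t * b t ^ 2 * c t ^ 3 * e t + t ^ 2 * b t ^ 2 * c t ^ 2 * d t ^ 2)
    (by fun_prop) (by simp)
    (fun t ht => (mul_eq_zero.1 (Eq.trans (by unfold quarticDisc; ring) (h t))).resolve_left ht) 0
  linear_combination hz / 16

theorem eq_zero_of_invariantRelation_of_simple_tangent {H : MvPolynomial (Fin 3) ℂ} {α β : ℂ}
    (hrel : InvariantRelation H α β) {a b c : Fin 3 → ℂ} {k : ℕ → ℕ → ℂ}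
    (hk : ∀ x y z : ℂ, eval (x • a + y • b + z • c) H = ternaryQuartic k x y z)
    (hsm : IsSmoothQuartic k) (h04 : k 0 4 = 0) (h13 : k 1 3 = 0) (h31 : k 3 1 = 0)
    (h22 : k 2 2 ≠ 0) : α = 0 ∧ β = 0 := by
  have hline : ∀ (l m q₀ q₁ q₂ q₃ q₄ : ℂ), (∀ x y : ℂ, ternaryQuartic k x y (l * x + m * y) =
      q₀ * x ^ 4 + q₁ * x ^ 3 * y + q₂ * x ^ 2 * y ^ 2 + q₃ * x * y ^ 3 + q₄ * y ^ 4) →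
      α * quarticI q₀ q₁ q₂ q₃ q₄ ^ 3 + β * quarticJ q₀ q₁ q₂ q₃ q₄ ^ 2 = 0 := by
    intro l m q₀ q₁ q₂ q₃ q₄ hq
    refine hrel (a + l • c) (b + m • c) _ _ _ _ _ fun x y => ?_
    rw [← hq, ← hk]
    congr 2
    module
  have hαβ : α + 4 * β = 0 := by
    have := hline 0 0 (k 4 0) 0 (k 2 2) 0 0 (fun x y => by
      simp only [ternaryQuartic, h04, h13, h31]
      ring)
    refine (mul_eq_zero.1 (?_ : k 2 2 ^ 6 * _ = 0)).resolve_left (pow_ne_zero _ h22)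
    unfold quarticI quarticJ at this
    linear_combination this
  by_cases hβ : β = 0
  · exact ⟨by simpa [hβ] using hαβ, hβ⟩
  exfalso
  have hdisc : ∀ (l m q₀ q₁ q₂ q₃ q₄ : ℂ), (∀ x y : ℂ, ternaryQuartic k x y (l * x + m * y) =
      q₀ * x ^ 4 + q₁ * x ^ 3 * y + q₂ * x ^ 2 * y ^ 2 + q₃ * x * y ^ 3 + q₄ * y ^ 4) →
      quarticDisc q₀ q₁ q₂ q₃ q₄ = 0 := by
    intro l m q₀ q₁ q₂ q₃ q₄ hq
    refine (mul_eq_zero.1 (?_ : (27 * β) * _ = 0)).resolve_left (by simpa using hβ)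
    linear_combination quarticI q₀ q₁ q₂ q₃ q₄ ^ 3 * hαβ - hline l m _ _ _ _ _ hq
      - β * four_mul_quarticI_pow_sub_quarticJ_sq q₀ q₁ q₂ q₃ q₄
  have h03 : k 0 3 ≠ 0 := by
    intro h03
    have := hsm 0 1 0 (by simp [ternaryQuarticX, h13]) (by simp [ternaryQuarticY, h04])
      (by simp [ternaryQuarticZ, h03])
    simp at this
  by_cases h40 : k 4 0 = 0
  · have h30 : k 3 0 ≠ 0 := by
      intro h30
      have := hsm 1 0 0 (by simp [ternaryQuarticX, h40]) (by simp [ternaryQuarticY, h31])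
        (by simp [ternaryQuarticZ, h30])
      simp at this
    have := eq_zero_of_quarticDisc_eq_zero_of_two_roots
      (a := fun t => k 3 0 + t * k 2 0 + t ^ 2 * k 1 0 + t ^ 3 * k 0 0)
      (b := fun t => k 3 0 + k 2 1 + t * (2 * k 2 0 + k 1 1) + t ^ 2 * (3 * k 1 0 + k 0 1)
        + 4 * t ^ 3 * k 0 0)
      (c := fun t => k 2 2 + t * (k 2 1 + k 1 2) + t ^ 2 * (k 2 0 + 2 * k 1 1 + k 0 2)
        + t ^ 3 * (3 * k 1 0 + 3 * k 0 1) + 6 * t ^ 4 * k 0 0)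
      (d := fun t => k 1 2 + k 0 3 + t * (k 1 1 + 2 * k 0 2) + t ^ 2 * (k 1 0 + 3 * k 0 1)
        + 4 * t ^ 3 * k 0 0)
      (e := fun t => k 0 3 + t * k 0 2 + t ^ 2 * k 0 1 + t ^ 3 * k 0 0)
      (by fun_prop) (by fun_prop) (by fun_prop) (by fun_prop) (by fun_prop)
      (fun t => hdisc t t _ _ _ _ _ fun x y => by
        simp only [ternaryQuartic, h04, h13, h31, h40]
        ring)
    simp [h30, h22, h03] at this
  · have := eq_zero_of_quarticDisc_eq_zero_of_root
      (a := fun _ => k 4 0) (b := fun t => t * k 3 0)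
      (c := fun t => k 2 2 + t * k 2 1 + t ^ 2 * k 2 0)
      (d := fun t => k 1 2 + t * k 1 1 + t ^ 2 * k 1 0)
      (e := fun t => k 0 3 + t * k 0 2 + t ^ 2 * k 0 1 + t ^ 3 * k 0 0)
      (by fun_prop) (by fun_prop) (by fun_prop) (by fun_prop) (by fun_prop) (by simp)
      (fun t => hdisc 0 t _ _ _ _ _ fun x y => by
        simp only [ternaryQuartic, h04, h13, h31]
        ring)
    simp [h40, h22, h03] at this

theorem exists_root_of_cubic (a₀ a₁ a₂ : ℂ) {a₃ : ℂ} (h : a₃ ≠ 0) :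
    ∃ y : ℂ, a₀ + a₁ * y + a₂ * y ^ 2 + a₃ * y ^ 3 = 0 := by
  obtain ⟨y, hy⟩ := IsAlgClosed.exists_root
    (Polynomial.C a₃ * Polynomial.X ^ 3 + Polynomial.C a₂ * Polynomial.X ^ 2
      + Polynomial.C a₁ * Polynomial.X + Polynomial.C a₀)
    (by rw [Polynomial.degree_cubic h]; decide)
  refine ⟨y, ?_⟩
  simp only [Polynomial.IsRoot, Polynomial.eval_add, Polynomial.eval_mul, Polynomial.eval_C,
    Polynomial.eval_pow, Polynomial.eval_X] at hy
  linear_combination hy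

theorem exists_ne_zero_eval_eq_zero {H : MvPolynomial (Fin 3) ℂ} (hH4 : H.IsHomogeneous 4) :
    ∃ p : Fin 3 → ℂ, p ≠ 0 ∧ eval p H = 0 := by
  obtain ⟨k, hk⟩ := exists_eval_eq_ternaryQuartic hH4
  by_cases h : k 4 0 = 0
  · exact ⟨![1, 0, 0], fun h0 => by simpa using congrFun h0 0, by simp [hk, ternaryQuartic, h]⟩
  · obtain ⟨x, hx⟩ := IsAlgClosed.exists_root
      (Polynomial.C (k 4 0) * Polynomial.X ^ 4 + (Polynomial.C (k 3 1) * Polynomial.X ^ 3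
        + Polynomial.C (k 2 2) * Polynomial.X ^ 2 + Polynomial.C (k 1 3) * Polynomial.X
        + Polynomial.C (k 0 4)))
      (by
        rw [Polynomial.degree_add_eq_left_of_degree_lt]
        · rw [Polynomial.degree_C_mul_X_pow 4 h]; decide
        · rw [Polynomial.degree_C_mul_X_pow 4 h]
          exact lt_of_le_of_lt Polynomial.degree_cubic_le (by decide))
    refine ⟨![x, 1, 0], fun h0 => by simpa using congrFun h0 1, ?_⟩
    rw [hk]
    simp only [Polynomial.IsRoot, Polynomial.eval_add, Polynomial.eval_mul, Polynomial.eval_C,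
      Polynomial.eval_pow, Polynomial.eval_X] at hx
    unfold ternaryQuartic
    linear_combination hx

theorem exists_tripleDet_ne_zero {p : Fin 3 → ℂ} (hp : p ≠ 0) :
    ∃ a c : Fin 3 → ℂ, tripleDet a p c ≠ 0 := by
  obtain ⟨i, hi⟩ := Function.ne_iff.1 hp
  fin_cases i
  · exact ⟨![0, 1, 0], ![0, 0, 1], by simpa [tripleDet] using hi⟩
  · exact ⟨![1, 0, 0], ![0, 0, 1], by simpa [tripleDet] using hi⟩
  · exact ⟨![1, 0, 0], ![0, 1, 0], by simpa [tripleDet] using hi⟩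

theorem tripleDet_comb (a b c : Fin 3 → ℂ) (x y z u v w : ℂ) :
    tripleDet (x • a + y • b + z • c) (u • a + v • b + w • c) c
      = (x * v - y * u) * tripleDet a b c := by
  simp only [tripleDet, Pi.add_apply, Pi.smul_apply, smul_eq_mul]
  ring

/-- A smooth plane quartic has a point with a tangent line, used as `z = 0`. -/
theorem exists_tangent_frame {H : MvPolynomial (Fin 3) ℂ} (hH4 : H.IsHomogeneous 4)
    (hH : ¬ ∃ p : Fin 3 → ℂ, p ≠ 0 ∧ eval p H = 0 ∧ ∀ k : Fin 3, eval p (pderiv k H) = 0) :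
    ∃ (a b c : Fin 3 → ℂ) (k : ℕ → ℕ → ℂ), tripleDet a b c ≠ 0 ∧
      (∀ x y z : ℂ, eval (x • a + y • b + z • c) H = ternaryQuartic k x y z) ∧
      k 0 4 = 0 ∧ k 1 3 = 0 ∧ k 0 3 ≠ 0 := by
  obtain ⟨p, hp, hpH⟩ := exists_ne_zero_eval_eq_zero hH4
  obtain ⟨a, c, hdet, k, hk, h03⟩ : ∃ a c : Fin 3 → ℂ, tripleDet a p c ≠ 0 ∧
      ∃ k : ℕ → ℕ → ℂ, (∀ x y z : ℂ, eval (x • a + y • p + z • c) H = ternaryQuartic k x y z) ∧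
        k 0 3 ≠ 0 := by
    obtain ⟨a, c, hdet⟩ := exists_tripleDet_ne_zero hp
    obtain ⟨k, hk⟩ := exists_eval_comb_eq_ternaryQuartic hH4 a p c
    by_cases h03 : k 0 3 = 0
    · have hdet' : tripleDet c p a ≠ 0 := by
        intro h
        refine hdet ?_
        unfold tripleDet at h ⊢
        linear_combination -h
      obtain ⟨k', hk'⟩ := exists_eval_comb_eq_ternaryQuartic hH4 c p a
      refine ⟨c, a, hdet', k', hk', fun h03' => ?_⟩
      have h04 : k 0 4 = 0 := by
        have := hk 0 1 0
        simpa [hpH, ternaryQuartic] using this.symm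
      have h13 : k 1 3 = 0 := by
        have hswap : ∀ x y z, ternaryQuartic k x y z = ternaryQuartic k' z y x := fun x y z => by
          rw [← hk, ← hk']
          congr 2
          module
        have := (binaryQuartic_coeff_unique (p₀ := k 4 0) (p₁ := k 3 1) (p₂ := k 2 2)
          (p₃ := k 1 3) (p₄ := k 0 4) (q₀ := k' 0 0) (q₁ := k' 0 1) (q₂ := k' 0 2) (q₃ := k' 0 3)
          (q₄ := k' 0 4) fun x y => by
            have := hswap x y 0
            simp only [ternaryQuartic] at this
            linear_combination this).2.2.2.1
        rw [this, h03']
      have := isSmoothQuartic_of_eval_comb hH hdet hk 0 1 0 (by simp [ternaryQuarticX, h13])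
        (by simp [ternaryQuarticY, h04]) (by simp [ternaryQuarticZ, h03])
      simp at this
    · exact ⟨a, c, hdet, k, hk, h03⟩
  have h04 : k 0 4 = 0 := by
    have := hk 0 1 0
    simpa [hpH, ternaryQuartic] using this.symm
  obtain ⟨k', hk'⟩ := exists_eval_comb_eq_ternaryQuartic hH4 (a - (k 1 3 / k 0 3) • c) p c
  have hcoord : ∀ x y z, ternaryQuartic k' x y z
      = ternaryQuartic k x y (z - k 1 3 / k 0 3 * x) := fun x y z => by
    rw [← hk, ← hk']
    congr 2
    module
  have hdet' : tripleDet (a - (k 1 3 / k 0 3) • c) p c ≠ 0 := by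
    have := tripleDet_comb a p c 1 0 (-(k 1 3 / k 0 3)) 0 1 0
    rw [show (1 : ℂ) • a + (0 : ℂ) • p + (-(k 1 3 / k 0 3)) • c = a - (k 1 3 / k 0 3) • c by module,
      show (0 : ℂ) • a + (1 : ℂ) • p + (0 : ℂ) • c = p by module] at this
    rw [this]
    simpa using hdet
  have h04' : k' 0 4 = 0 := by
    have := hk' 0 1 0
    simpa [hpH, ternaryQuartic] using this.symm
  generalize hτ : k 1 3 / k 0 3 = τ at *
  have hτ' : k 1 3 = τ * k 0 3 := by
    rw [← hτ]
    field_simp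
  have h13' : k' 1 3 = 0 := by
    refine Eq.trans (binaryQuartic_coeff_unique (p₀ := k' 4 0) (p₁ := k' 3 1) (p₂ := k' 2 2)
      (p₃ := k' 1 3) (p₄ := k' 0 4)
      (q₀ := k 4 0 - τ * k 3 0 + τ ^ 2 * k 2 0 - τ ^ 3 * k 1 0 + τ ^ 4 * k 0 0)
      (q₁ := k 3 1 - τ * k 2 1 + τ ^ 2 * k 1 1 - τ ^ 3 * k 0 1)
      (q₂ := k 2 2 - τ * k 1 2 + τ ^ 2 * k 0 2)
      (q₃ := k 1 3 - τ * k 0 3) (q₄ := k 0 4) fun x y => ?_).2.2.2.1 ?_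
    · have := hcoord x y 0
      simp only [ternaryQuartic] at this
      linear_combination this
    · linear_combination hτ'
  refine ⟨_, p, c, k', hdet', hk', h04', h13', fun h03' => ?_⟩
  have := isSmoothQuartic_of_eval_comb hH hdet' hk' 0 1 0 (by simp [ternaryQuarticX, h13'])
        (by simp [ternaryQuarticY, h04']) (by simp [ternaryQuarticZ, h03'])
  simp at this

/-- `ternaryQuartic k` restricted to the affine chart `y = 1`. -/
noncomputable def affineQuarticPoly (k : ℕ → ℕ → ℂ) : MvPolynomial (Fin 2) ℂ :=
  C (k 4 0) * X 0 ^ 4 + C (k 3 1) * X 0 ^ 3 + C (k 2 2) * X 0 ^ 2 + C (k 1 3) * X 0 + C (k 0 4)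
    + X 1 * (C (k 3 0) * X 0 ^ 3 + C (k 2 1) * X 0 ^ 2 + C (k 1 2) * X 0 + C (k 0 3))
    + X 1 ^ 2 * (C (k 2 0) * X 0 ^ 2 + C (k 1 1) * X 0 + C (k 0 2))
    + X 1 ^ 3 * (C (k 1 0) * X 0 + C (k 0 1)) + C (k 0 0) * X 1 ^ 4

theorem eval_affineQuarticPoly (k : ℕ → ℕ → ℂ) (x z : ℂ) :
    eval ![x, z] (affineQuarticPoly k) = ternaryQuartic k x 1 z := by
  simp [affineQuarticPoly, ternaryQuartic]

theorem eval_pderiv_zero_affineQuarticPoly (k : ℕ → ℕ → ℂ) (x z : ℂ) :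
    eval ![x, z] (pderiv 0 (affineQuarticPoly k)) = ternaryQuarticX k x 1 z := by
  simp [affineQuarticPoly, ternaryQuarticX, pderiv_X, Derivation.leibniz, Derivation.leibniz_pow]
  ring

theorem eval_pderiv_one_affineQuarticPoly (k : ℕ → ℕ → ℂ) (x z : ℂ) :
    eval ![x, z] (pderiv 1 (affineQuarticPoly k)) = ternaryQuarticZ k x 1 z := by
  simp [affineQuarticPoly, ternaryQuarticZ, pderiv_X, Derivation.leibniz, Derivation.leibniz_pow]
  ring

theorem eval_pderiv_pderiv_affineQuarticPoly (k : ℕ → ℕ → ℂ) (x z : ℂ) :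
    eval ![x, z] (pderiv 0 (pderiv 0 (affineQuarticPoly k))) =
      12 * k 4 0 * x ^ 2 + 6 * k 3 1 * x + 2 * k 2 2 + z * (6 * k 3 0 * x + 2 * k 2 1)
        + 2 * z ^ 2 * k 2 0 ∧
    eval ![x, z] (pderiv 1 (pderiv 0 (affineQuarticPoly k))) =
      3 * k 3 0 * x ^ 2 + 2 * k 2 1 * x + k 1 2 + 2 * z * (2 * k 2 0 * x + k 1 1)
        + 3 * z ^ 2 * k 1 0 ∧
    eval ![x, z] (pderiv 0 (pderiv 1 (affineQuarticPoly k))) =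
      3 * k 3 0 * x ^ 2 + 2 * k 2 1 * x + k 1 2 + 2 * z * (2 * k 2 0 * x + k 1 1)
        + 3 * z ^ 2 * k 1 0 ∧
    eval ![x, z] (pderiv 1 (pderiv 1 (affineQuarticPoly k))) =
      2 * (k 2 0 * x ^ 2 + k 1 1 * x + k 0 2) + 6 * z * (k 1 0 * x + k 0 1)
        + 12 * z ^ 2 * k 0 0 := by
  have hnum : ∀ (i : Fin 2) (n : ℕ) [n.AtLeastTwo],
      pderiv i (OfNat.ofNat n : MvPolynomial (Fin 2) ℂ) = 0 := fun i n _ =>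
    Derivation.map_natCast (pderiv i) n
  refine ⟨?_, ?_, ?_, ?_⟩ <;>
  · simp [affineQuarticPoly, pderiv_X, Derivation.leibniz, Derivation.leibniz_pow, hnum]
    ring

/-- A smooth plane quartic has a tangent line at which the contact order is exactly two. -/
theorem exists_simple_tangent {H : MvPolynomial (Fin 3) ℂ} (hH4 : H.IsHomogeneous 4)
    (hH : ¬ ∃ p : Fin 3 → ℂ, p ≠ 0 ∧ eval p H = 0 ∧ ∀ k : Fin 3, eval p (pderiv k H) = 0) :
    ∃ (a b c : Fin 3 → ℂ) (k : ℕ → ℕ → ℂ), tripleDet a b c ≠ 0 ∧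
      (∀ x y z : ℂ, eval (x • a + y • b + z • c) H = ternaryQuartic k x y z) ∧
      k 0 4 = 0 ∧ k 1 3 = 0 ∧ k 2 2 ≠ 0 := by
  by_contra! hall
  obtain ⟨a, b, c, k, hdet, hk, h04, h13, h03⟩ := exists_tangent_frame hH4 hH
  have hev : ∀ᶠ x in 𝓝 (0 : ℂ), ternaryQuartic k x 1 0 = 0 := by
    have := eventually_eval_eq_zero_of_flex (affineQuarticPoly k)
      (by simp [eval_affineQuarticPoly, ternaryQuartic, h04])
      (by simp [eval_pderiv_zero_affineQuarticPoly, ternaryQuarticX, h13])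
      (by simp [eval_pderiv_one_affineQuarticPoly, ternaryQuarticZ, h03])
      (by
        intro x z hF hFz
        obtain ⟨hxx, hzx, hxz, hzz⟩ := eval_pderiv_pderiv_affineQuarticPoly k x z
        rw [hxx, hzx, hxz, hzz, eval_pderiv_zero_affineQuarticPoly,
          eval_pderiv_one_affineQuarticPoly]
        rw [eval_pderiv_one_affineQuarticPoly] at hFz
        rw [eval_affineQuarticPoly] at hF
        have hXZ : ternaryQuarticX k x 1 z * ternaryQuarticZ k x 1 z
          - ternaryQuarticZ k x 1 z * ternaryQuarticX k x 1 z = 0 := by ring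
        generalize hα : ternaryQuarticZ k x 1 z = α at hXZ hFz ⊢
        generalize hγ : ternaryQuarticX k x 1 z = γ at hXZ ⊢
        have hdet' : tripleDet (α • a + (0 : ℂ) • b + (-γ) • c)
            (x • a + (1 : ℂ) • b + z • c) c ≠ 0 := by
          rw [tripleDet_comb]
          simpa using ⟨hFz, hdet⟩
        obtain ⟨k', hk'⟩ := exists_eval_comb_eq_ternaryQuartic hH4
          (α • a + (0 : ℂ) • b + (-γ) • c) (x • a + (1 : ℂ) • b + z • c) c
        have hcoord : ∀ p q, ternaryQuartic k' p q 0
            = ternaryQuartic k (p * α + q * x) q (q * z - p * γ) := fun p q => by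
          rw [← hk, ← hk']
          congr 2
          module
        obtain ⟨-, -, h22', h13', h04'⟩ := binaryQuartic_coeff_unique (p₀ := k' 4 0) (p₁ := k' 3 1)
          (p₂ := k' 2 2) (p₃ := k' 1 3) (p₄ := k' 0 4)
          (q₀ := ternaryQuartic k α 0 (-γ))
          (q₁ := x * ternaryQuarticX k α 0 (-γ) + ternaryQuarticY k α 0 (-γ)
            + z * ternaryQuarticZ k α 0 (-γ))
          (q₂ := ((12 * k 4 0 * x ^ 2 + 6 * k 3 1 * x + 2 * k 2 2 + z * (6 * k 3 0 * x + 2 * k 2 1)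
            + 2 * z ^ 2 * k 2 0) * α ^ 2 - 2 * (3 * k 3 0 * x ^ 2 + 2 * k 2 1 * x + k 1 2
            + 2 * z * (2 * k 2 0 * x + k 1 1) + 3 * z ^ 2 * k 1 0) * γ * α
            + (2 * (k 2 0 * x ^ 2 + k 1 1 * x + k 0 2) + 6 * z * (k 1 0 * x + k 0 1)
            + 12 * z ^ 2 * k 0 0) * γ ^ 2) / 2)
          (q₃ := ternaryQuarticX k x 1 z * α - ternaryQuarticZ k x 1 z * γ)
          (q₄ := ternaryQuartic k x 1 z) (fun p q => by
            have := hcoord p q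
            simp only [ternaryQuartic, ternaryQuarticX, ternaryQuarticY, ternaryQuarticZ] at this ⊢
            linear_combination this)
        have := hall _ _ _ k' hdet' hk' (by rw [h04', hF]) (by rw [h13', hα, hγ, hXZ])
        rw [this] at h22'
        linear_combination -2 * h22')
    simpa only [eval_affineQuarticPoly] using this
  have hzero : k 4 0 = 0 ∧ k 3 1 = 0 ∧ k 2 2 = 0 := by
    have hp : (Polynomial.C (k 4 0) * Polynomial.X ^ 4 + Polynomial.C (k 3 1) * Polynomial.X ^ 3
        + Polynomial.C (k 2 2) * Polynomial.X ^ 2 : Polynomial ℂ) = 0 := by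
      refine Polynomial.eq_zero_of_infinite_isRoot _ ((infinite_of_mem_nhds 0 hev).mono ?_)
      intro x hx
      simpa [ternaryQuartic, h04, h13] using hx
    have hc := fun n => congrArg (fun p => Polynomial.coeff p n) hp
    exact ⟨by simpa [Polynomial.coeff_X_pow] using hc 4, by simpa [Polynomial.coeff_X_pow] using hc 3,
      by simpa [Polynomial.coeff_X_pow] using hc 2⟩
  obtain ⟨h40, h31, h22⟩ := hzero
  obtain ⟨y, hy⟩ := exists_root_of_cubic (k 3 0) (k 2 1) (k 1 2) h03
  have := isSmoothQuartic_of_eval_comb hH hdet hk 1 y 0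
    (by simp [ternaryQuarticX, h40, h31, h22, h13]) (by simp [ternaryQuarticY, h31, h22, h13, h04])
    (by simpa [ternaryQuarticZ] using hy)
  simp at this

theorem eq_zero_of_invariantRelation {H : MvPolynomial (Fin 3) ℂ} (hH4 : H.IsHomogeneous 4)
    (hH : ¬ ∃ p : Fin 3 → ℂ, p ≠ 0 ∧ eval p H = 0 ∧ ∀ k : Fin 3, eval p (pderiv k H) = 0)
    {α β : ℂ} (hrel : InvariantRelation H α β) : α = 0 ∧ β = 0 := by
  obtain ⟨a, b, c, k, hdet, hk, h04, h13, h22⟩ := exists_simple_tangent hH4 hH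
  obtain ⟨τ, hτ⟩ : ∃ τ : ℂ, k 3 1 = 2 * τ * k 2 2 := ⟨k 3 1 / (2 * k 2 2), by field_simp⟩
  obtain ⟨k', hk'⟩ := exists_eval_comb_eq_ternaryQuartic hH4 (a - τ • b) b c
  have hdet' : tripleDet (a - τ • b) b c ≠ 0 := by
    have := tripleDet_comb a b c 1 (-τ) 0 0 1 0
    rw [show (1 : ℂ) • a + (-τ) • b + (0 : ℂ) • c = a - τ • b by module,
      show (0 : ℂ) • a + (1 : ℂ) • b + (0 : ℂ) • c = b by module] at this
    rw [this]
    simpa using hdet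
  have hcoord : ∀ x y z, ternaryQuartic k' x y z = ternaryQuartic k x (y - τ * x) z :=
    fun x y z => by
      rw [← hk, ← hk']
      congr 2
      module
  obtain ⟨-, h31', h22', h13', h04'⟩ := binaryQuartic_coeff_unique (p₀ := k' 4 0) (p₁ := k' 3 1)
    (p₂ := k' 2 2) (p₃ := k' 1 3) (p₄ := k' 0 4) (q₀ := k 4 0 - τ * k 3 1 + τ ^ 2 * k 2 2)
    (q₁ := 0) (q₂ := k 2 2) (q₃ := 0) (q₄ := 0) (fun x y => by
      have := hcoord x y 0
      simp only [ternaryQuartic, h04, h13] at this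
      linear_combination this + x ^ 3 * y * hτ)
  exact eq_zero_of_invariantRelation_of_simple_tangent hrel hk'
    (isSmoothQuartic_of_eval_comb hH hdet' hk') h04' h13' h31' (by rwa [h22'])

/-- For a smooth plane quartic `H`, the covariants satisfy: `g₄³` and `g₆²` are linearly
independent over `ℂ`; in particular `g₄ ≠ 0` and the `j`-function
`j_C = 1728·4g₄³/(4g₄³ − 27g₆²)` is not a constant rational function. -/
theorem stmt_19 (H : MvPolynomial (Fin 3) ℂ) (hH4 : H.IsHomogeneous 4)
    (hHsmooth : ¬ ∃ p : Fin 3 → ℂ, p ≠ 0 ∧ eval p H = 0 ∧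
      ∀ k : Fin 3, eval p (pderiv k H) = 0)
    (b₀ b₁ b₂ b₃ b₄ : MvPolynomial (Fin 3) ℂ)
    (hb : ∀ s t u x y : ℂ,
      eval ![x * u, y * u, -(s * x + t * y)] H
        = eval ![s, t, u] b₀ * x ^ 4 + eval ![s, t, u] b₁ * x ^ 3 * y
          + eval ![s, t, u] b₂ * x ^ 2 * y ^ 2 + eval ![s, t, u] b₃ * x * y ^ 3
          + eval ![s, t, u] b₄ * y ^ 4)
    (h₂ h₃ : MvPolynomial (Fin 3) ℂ)
    (hh₂ : h₂ = C (1 / 3 : ℂ) * (-3 * b₁ * b₃ + 12 * b₀ * b₄ + b₂ ^ 2))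
    (hh₃ : h₃ = C (1 / 27 : ℂ) * (72 * b₀ * b₂ * b₄ - 27 * b₀ * b₃ ^ 2 - 27 * b₁ ^ 2 * b₄
      + 9 * b₁ * b₂ * b₃ - 2 * b₂ ^ 3))
    (g₄ g₆ : MvPolynomial (Fin 3) ℂ)
    (hg₄h : g₄.IsHomogeneous 4) (hg₆h : g₆.IsHomogeneous 6)
    (hfac₄ : h₂ = X 2 ^ 4 * g₄) (hfac₆ : h₃ = X 2 ^ 6 * g₆) :
    LinearIndependent ℂ ![g₄ ^ 3, g₆ ^ 2] ∧ g₄ ≠ 0 ∧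
      ¬ ∃ c : ℂ, (1728 : MvPolynomial (Fin 3) ℂ) * (4 * g₄ ^ 3)
        = C c * (4 * g₄ ^ 3 - 27 * g₆ ^ 2) := by
  have key : ∀ s t : ℂ, s • g₄ ^ 3 + t • g₆ ^ 2 = 0 → s = 0 ∧ t = 0 := by
    intro α β hαβ
    have hrel : InvariantRelation H (27 * α) β := by
      refine invariantRelation_of_standard_lines hH4 hb fun s t u => ?_
      have h4 := congrArg (eval ![s, t, u]) (hh₂.symm.trans hfac₄)
      have h6 := congrArg (eval ![s, t, u]) (hh₃.symm.trans hfac₆)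
      have h0 := congrArg (eval ![s, t, u]) hαβ
      simp only [map_add, map_sub, map_mul, map_pow, map_neg, map_ofNat, eval_C, eval_X, smul_eval,
        map_zero, Matrix.cons_val] at h4 h6 h0
      have hI : quarticI (eval ![s, t, u] b₀) (eval ![s, t, u] b₁) (eval ![s, t, u] b₂)
          (eval ![s, t, u] b₃) (eval ![s, t, u] b₄) = 3 * (u ^ 4 * eval ![s, t, u] g₄) := by
        unfold quarticI
        linear_combination 3 * h4
      have hJ : quarticJ (eval ![s, t, u] b₀) (eval ![s, t, u] b₁) (eval ![s, t, u] b₂)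
          (eval ![s, t, u] b₃) (eval ![s, t, u] b₄) = 27 * (u ^ 6 * eval ![s, t, u] g₆) := by
        unfold quarticJ
        linear_combination 27 * h6
      rw [hI, hJ]
      linear_combination 729 * u ^ 12 * h0
    obtain ⟨h1, h2⟩ := eq_zero_of_invariantRelation hH4 hHsmooth hrel
    exact ⟨by simpa using h1, h2⟩
  refine ⟨LinearIndependent.pair_iff.2 key, fun h => ?_, fun ⟨c, hc⟩ => ?_⟩
  · exact one_ne_zero (key 1 0 (by simp [h])).1
  · obtain ⟨h1, h2⟩ := key (6912 - 4 * c) (27 * c) (by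
      simp only [smul_eq_C_mul, map_sub, map_mul, map_ofNat]
      linear_combination hc)
    have hc0 : c = 0 := by simpa using h2
    norm_num [hc0] at h1
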